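/- arXiv:2110.05693 — 2 statements merged into one kernel-verified Lean document; each statement's English description precedes it below -/
import Mathlib

section
/- Let F be a field and let x, y, z ∈ Mat_2(F). The 8×8 block matrix v(x,y,z) belongs to Sp_8(F) if and only if z − x·y* ∈ Mat_2^0(F), where y* = J_2 ᵗy J_2. -/
open Matrix

namespace GS

noncomputable section

/-- `Jmat F n` : the `n × n` matrix over `F` with ones on the antidiagonal, zeros elsewhere. -/
def Jmat (F : Type*) [Field F] (n : ℕ) : Matrix (Fin n) (Fin n) F :=
  Matrix.of fun i j => if (i : ℕ) + (j : ℕ) = n - 1 then (1 : F) else 0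

/-- The symplectic form matrix `((0, J_n), (-J_n, 0))` in `n × n` block form. -/
def OmegaMat (F : Type*) [Field F] (n : ℕ) : Matrix (Fin (n + n)) (Fin (n + n)) F :=
  Matrix.reindex finSumFinEquiv finSumFinEquiv
    (Matrix.fromBlocks 0 (Jmat F n) (-(Jmat F n)) 0)

/-- `Sp_{2n}(F) = { g : ᵗg Ω g = Ω }`. -/
def SpSet (F : Type*) [Field F] (n : ℕ) : Set (Matrix (Fin (n + n)) (Fin (n + n)) F) :=
  {g | gᵀ * OmegaMat F n * g = OmegaMat F n}

/-- `Sp_4(F)`. -/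
def Sp4 (F : Type*) [Field F] : Set (Matrix (Fin 4) (Fin 4) F) := SpSet F 2

/-- `Sp_8(F)`. -/
def Sp8 (F : Type*) [Field F] : Set (Matrix (Fin 8) (Fin 8) F) := SpSet F 4

/-- `Sp_16(F)`. -/
def Sp16 (F : Type*) [Field F] : Set (Matrix (Fin 16) (Fin 16) F) := SpSet F 8

/-- `Mat_2^0(F) = { A : ᵗA J₂ = J₂ A }`. -/
def Mat20 (F : Type*) [Field F] : Set (Matrix (Fin 2) (Fin 2) F) :=
  {A | Aᵀ * Jmat F 2 = Jmat F 2 * A}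

/-- `y* = J₂ ᵗy J₂`. -/
def starJ (F : Type*) [Field F] (y : Matrix (Fin 2) (Fin 2) F) : Matrix (Fin 2) (Fin 2) F :=
  Jmat F 2 * yᵀ * Jmat F 2

/-- Assemble an `8 × 8` matrix from sixteen `2 × 2` blocks. -/
def blk8 (F : Type*) [Field F] (B : Fin 4 → Fin 4 → Matrix (Fin 2) (Fin 2) F) :
    Matrix (Fin 8) (Fin 8) F :=
  Matrix.of fun i j =>
    B ⟨(i : ℕ) / 2, by have := i.isLt; omega⟩ ⟨(j : ℕ) / 2, by have := j.isLt; omega⟩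
      ⟨(i : ℕ) % 2, by omega⟩ ⟨(j : ℕ) % 2, by omega⟩

/-- The matrix `v(x, y, z)`: identity except block `(1,2) = x`, `(1,3) = y`,
`(1,4) = z`, `(2,4) = y* = J₂ ᵗy J₂`, `(3,4) = x* = -J₂ ᵗx J₂`. -/
def vMat (F : Type*) [Field F] (x y z : Matrix (Fin 2) (Fin 2) F) :
    Matrix (Fin 8) (Fin 8) F :=
  blk8 F fun bi bj =>
    if bi = bj then (1 : Matrix (Fin 2) (Fin 2) F)
    else if bi = 0 ∧ bj = 1 then x
    else if bi = 0 ∧ bj = 2 then y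
    else if bi = 0 ∧ bj = 3 then z
    else if bi = 1 ∧ bj = 3 then starJ F y
    else if bi = 2 ∧ bj = 3 then -(starJ F x)
    else 0

/-- `N_{2,8}(F)`. -/
def N28 (F : Type*) [Field F] : Set (Matrix (Fin 8) (Fin 8) F) :=
  {M | ∃ x y z : Matrix (Fin 2) (Fin 2) F,
    z - x * starJ F y ∈ Mat20 F ∧ M = vMat F x y z}

/-- The center subgroup `N_{2,8}^c(F) = { v(0,0,z) : z ∈ Mat_2^0(F) }`. -/
def N28c (F : Type*) [Field F] : Set (Matrix (Fin 8) (Fin 8) F) :=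
  {M | ∃ z ∈ Mat20 F, M = vMat F 0 0 z}

/-- The underlying set of the Heisenberg group `H_9(F)`. -/
abbrev H9 (F : Type*) [Field F] :=
  Matrix (Fin 2) (Fin 2) F × Matrix (Fin 2) (Fin 2) F × F

/-- The Heisenberg multiplication on `H_9(F)` attached to `T`. -/
def H9mul (F : Type*) [Field F] (T : Matrix (Fin 2) (Fin 2) F) (a b : H9 F) : H9 F :=
  (a.1 + b.1, a.2.1 + b.2.1,
    a.2.2 + b.2.2 +
      (T * (a.1 * (Jmat F 2 * b.2.1ᵀ * Jmat F 2) -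
            a.2.1 * (Jmat F 2 * b.1ᵀ * Jmat F 2))).trace)

/-- The `8 × 8` block diagonal matrix `diag(m, h, m')` with blocks of sizes `2, 4, 2`. -/
def diag242 (F : Type*) [Field F] (m : Matrix (Fin 2) (Fin 2) F)
    (h : Matrix (Fin 4) (Fin 4) F) (m' : Matrix (Fin 2) (Fin 2) F) :
    Matrix (Fin 8) (Fin 8) F :=
  Matrix.of fun i j =>
    if hi : (i : ℕ) < 2 then
      if hj : (j : ℕ) < 2 then m ⟨(i : ℕ), hi⟩ ⟨(j : ℕ), hj⟩ else 0
    else if hi2 : (i : ℕ) < 6 then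
      if hj2 : 2 ≤ (j : ℕ) ∧ (j : ℕ) < 6 then
        h ⟨(i : ℕ) - 2, by omega⟩ ⟨(j : ℕ) - 2, by omega⟩
      else 0
    else
      if hj3 : 6 ≤ (j : ℕ) then
        m' ⟨(i : ℕ) - 6, by have := i.isLt; omega⟩ ⟨(j : ℕ) - 6, by have := j.isLt; omega⟩
      else 0

/-- The segment (`{1,2}`, `{3,4,5,6}` or `{7,8}`) of an index in `Fin 8`. -/
def seg8 (i : Fin 8) : ℕ := if (i : ℕ) < 2 then 0 else if (i : ℕ) < 6 then 1 else 2

/-- `w = ((0, I₂), (I₂, 0))`. -/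
def wMat (F : Type*) [Field F] : Matrix (Fin 4) (Fin 4) F :=
  Matrix.reindex finSumFinEquiv finSumFinEquiv
    (Matrix.fromBlocks (0 : Matrix (Fin 2) (Fin 2) F) (1 : Matrix (Fin 2) (Fin 2) F)
      (1 : Matrix (Fin 2) (Fin 2) F) (0 : Matrix (Fin 2) (Fin 2) F))

/-- The embedding `t : Sp₄ × Sp₄ → Mat₁₆`, with respect to the partition of `{1,…,16}`
into `I₁ = {1,…,4}`, `I₂ = {5,6}`, `I₃ = {7,…,10}`, `I₄ = {11,12}`, `I₅ = {13,…,16}`: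
block `(I₁,I₁) = g₁`, `(I₃,I₃) = g₂`, `(I₅,I₅) = J₄ ᵗg₁⁻¹ J₄`, `(I₂,I₂) = g_{1,1}`,
`(I₂,I₄) = g_{1,2}`, `(I₄,I₂) = g_{1,3}`, `(I₄,I₄) = g_{1,4}`, all other blocks zero. -/
def tEmb (F : Type*) [Field F] (g₁ g₂ : Matrix (Fin 4) (Fin 4) F) :
    Matrix (Fin 16) (Fin 16) F :=
  Matrix.of fun i j =>
    if hi1 : (i : ℕ) < 4 then
      if hj1 : (j : ℕ) < 4 then g₁ ⟨(i : ℕ), hi1⟩ ⟨(j : ℕ), hj1⟩ else 0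
    else if hi2 : (i : ℕ) < 6 then
      if hj2 : 4 ≤ (j : ℕ) ∧ (j : ℕ) < 6 then
        g₁ ⟨(i : ℕ) - 4, by omega⟩ ⟨(j : ℕ) - 4, by omega⟩
      else if hj4 : 10 ≤ (j : ℕ) ∧ (j : ℕ) < 12 then
        g₁ ⟨(i : ℕ) - 4, by omega⟩ ⟨(j : ℕ) - 10 + 2, by omega⟩
      else 0
    else if hi3 : (i : ℕ) < 10 then
      if hj3 : 6 ≤ (j : ℕ) ∧ (j : ℕ) < 10 then
        g₂ ⟨(i : ℕ) - 6, by omega⟩ ⟨(j : ℕ) - 6, by omega⟩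
      else 0
    else if hi4 : (i : ℕ) < 12 then
      if hj2 : 4 ≤ (j : ℕ) ∧ (j : ℕ) < 6 then
        g₁ ⟨(i : ℕ) - 10 + 2, by omega⟩ ⟨(j : ℕ) - 4, by omega⟩
      else if hj4 : 10 ≤ (j : ℕ) ∧ (j : ℕ) < 12 then
        g₁ ⟨(i : ℕ) - 10 + 2, by omega⟩ ⟨(j : ℕ) - 10 + 2, by omega⟩
      else 0
    else
      if hj5 : 12 ≤ (j : ℕ) then
        (Jmat F 4 * (g₁⁻¹)ᵀ * Jmat F 4) ⟨(i : ℕ) - 12, by have := i.isLt; omega⟩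
          ⟨(j : ℕ) - 12, by have := j.isLt; omega⟩
      else 0

/-- `γ₁`: entry `(1,8) = -1`, entries `(k,k) = 1` for `2 ≤ k ≤ 7`, entry `(8,1) = 1`
(1-indexed), all other entries `0`. -/
def gamma1 (F : Type*) [Field F] : Matrix (Fin 8) (Fin 8) F :=
  Matrix.of fun i j =>
    if (i : ℕ) = 0 ∧ (j : ℕ) = 7 then -1
    else if (i : ℕ) = 7 ∧ (j : ℕ) = 0 then 1
    else if i = j ∧ 1 ≤ (i : ℕ) ∧ (i : ℕ) ≤ 6 then 1
    else 0

/-- `γ₂`: block (rows 1–2, columns 7–8) `= -I₂`, block (rows 3–6, columns 3–6) `= I₄`,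
block (rows 7–8, columns 1–2) `= I₂` (1-indexed), all other entries `0`. -/
def gamma2 (F : Type*) [Field F] : Matrix (Fin 8) (Fin 8) F :=
  Matrix.of fun i j =>
    if (i : ℕ) < 2 ∧ (j : ℕ) = (i : ℕ) + 6 then -1
    else if 2 ≤ (i : ℕ) ∧ (i : ℕ) < 6 ∧ i = j then 1
    else if 6 ≤ (i : ℕ) ∧ (j : ℕ) + 6 = (i : ℕ) then 1
    else 0

/-- The Siegel parabolic `P_8(F)` of `Sp_8(F)`: lower-left `4 × 4` block zero. -/
def P8 (F : Type*) [Field F] : Set (Matrix (Fin 8) (Fin 8) F) :=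
  {g | g ∈ Sp8 F ∧ ∀ i j : Fin 8, 4 ≤ (i : ℕ) → (j : ℕ) < 4 → g i j = 0}

/-- The Siegel parabolic `P_4(F)` of `Sp_4(F)`: lower-left `2 × 2` block zero. -/
def P4 (F : Type*) [Field F] : Set (Matrix (Fin 4) (Fin 4) F) :=
  {h | h ∈ Sp4 F ∧ ∀ i j : Fin 4, 2 ≤ (i : ℕ) → (j : ℕ) < 2 → h i j = 0}

/-- The span of the first two standard basis vectors `e₁, e₂` of `F^8`. -/
def E2 (F : Type*) [Field F] : Submodule F (Fin 8 → F) :=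
  Submodule.span F {Pi.single (0 : Fin 8) (1 : F), Pi.single (1 : Fin 8) (1 : F)}

/-- `P_{2,8}(F)`: elements of `Sp_8(F)` mapping the span of `e₁, e₂` onto itself. -/
def P28 (F : Type*) [Field F] : Set (Matrix (Fin 8) (Fin 8) F) :=
  {g | g ∈ Sp8 F ∧ Submodule.map g.mulVecLin (E2 F) = E2 F}

/-- The double coset `P_8(F) · γ · P_{2,8}(F)`. -/
def dcoset (F : Type*) [Field F] (γ : Matrix (Fin 8) (Fin 8) F) :
    Set (Matrix (Fin 8) (Fin 8) F) :=
  {g | ∃ p ∈ P8 F, ∃ q ∈ P28 F, g = p * γ * q}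

/-- The orbit of `ξ` under the right multiplication action of `GL₂(F)` on `Mat₂(F)`. -/
def rOrbit (F : Type*) [Field F] (ξ : Matrix (Fin 2) (Fin 2) F) :
    Set (Matrix (Fin 2) (Fin 2) F) :=
  {A | ∃ g, IsUnit g ∧ A = ξ * g}


lemma blk8_mul {F : Type*} [Field F] (B C : Fin 4 → Fin 4 → Matrix (Fin 2) (Fin 2) F) :
    blk8 F B * blk8 F C = blk8 F fun i j => ∑ k, B i k * C k j := by
  ext i j
  simp [blk8, Matrix.mul_apply, Fin.sum_univ_four, Fin.sum_univ_eight, add_assoc]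

lemma blk8_transpose {F : Type*} [Field F] (B : Fin 4 → Fin 4 → Matrix (Fin 2) (Fin 2) F) :
    (blk8 F B)ᵀ = blk8 F fun i j => (B j i)ᵀ := rfl

lemma blk8_injective {F : Type*} [Field F] : Function.Injective (blk8 F) := by
  intro B C h
  ext a b i j
  have key := congrFun₂ h ⟨2 * a + i, by omega⟩ ⟨2 * b + j, by omega⟩
  have hdiv (a : Fin 4) (i : Fin 2) (h) : (⟨(2 * a + i : ℕ) / 2, h⟩ : Fin 4) = a :=
    Fin.ext (by simp; omega)
  have hmod (a : Fin 4) (i : Fin 2) (h) : (⟨(2 * a + i : ℕ) % 2, h⟩ : Fin 2) = i :=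
    Fin.ext (by simp; omega)
  simpa only [blk8, Matrix.of_apply, hdiv, hmod] using key

lemma omegaMat_apply {F : Type*} [Field F] {n : ℕ} (i j : Fin (n + n)) :
    OmegaMat F n i j =
      if (i : ℕ) + j = 2 * n - 1 then if (i : ℕ) < n then 1 else -1 else 0 := by
  obtain ⟨i, rfl⟩ := finSumFinEquiv.surjective i
  obtain ⟨j, rfl⟩ := finSumFinEquiv.surjective j
  have h : OmegaMat F n (finSumFinEquiv i) (finSumFinEquiv j) =
      fromBlocks 0 (Jmat F n) (-Jmat F n) 0 i j := by
    simp only [OmegaMat, reindex_apply, submatrix_apply, Equiv.symm_apply_apply]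
  rw [h]
  rcases i with i | i <;> rcases j with j | j <;>
    simp only [Jmat, fromBlocks_apply₁₁, fromBlocks_apply₁₂, fromBlocks_apply₂₁,
      fromBlocks_apply₂₂, Matrix.zero_apply, Matrix.neg_apply, of_apply,
      finSumFinEquiv_apply_left, finSumFinEquiv_apply_right, Fin.val_castAdd, Fin.val_natAdd] <;>
    split_ifs <;> first | omega | simp [*]

lemma omegaMat_four_eq_blk8 (F : Type*) [Field F] :
    OmegaMat F 4 = blk8 F
      ![![0, 0, 0, Jmat F 2], ![0, 0, Jmat F 2, 0],
        ![0, -Jmat F 2, 0, 0], ![-Jmat F 2, 0, 0, 0]] := by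
  have h (i j : Fin 8) :
      (if (i : ℕ) + j = 7 then if (i : ℕ) < 4 then (1 : F) else -1 else 0) = blk8 F
        ![![0, 0, 0, Jmat F 2], ![0, 0, Jmat F 2, 0],
          ![0, -Jmat F 2, 0, 0], ![-Jmat F 2, 0, 0, 0]] i j := by
    fin_cases i <;> fin_cases j <;> first | rfl | exact neg_zero.symm
  ext i j
  exact (omegaMat_apply i j).trans (h i j)

lemma vMat_eq_blk8 {F : Type*} [Field F] (x y z : Matrix (Fin 2) (Fin 2) F) :
    vMat F x y z = blk8 F
      ![![1, x, y, z], ![0, 1, 0, starJ F y], ![0, 0, 1, -starJ F x], ![0, 0, 0, 1]] := by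
  unfold vMat
  congr 1
  funext i j
  fin_cases i <;> fin_cases j <;> rfl

lemma Jmat_transpose (F : Type*) [Field F] (n : ℕ) : (Jmat F n)ᵀ = Jmat F n := by
  ext i j
  simp [Jmat, add_comm]

lemma Jmat_two_mul_self (F : Type*) [Field F] : Jmat F 2 * Jmat F 2 = 1 := by
  ext i j
  fin_cases i <;> fin_cases j <;> simp [Jmat, Matrix.mul_apply]

lemma Jmat_two_mul_starJ {F : Type*} [Field F] (x : Matrix (Fin 2) (Fin 2) F) :
    Jmat F 2 * starJ F x = xᵀ * Jmat F 2 := by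
  rw [starJ, ← Matrix.mul_assoc, ← Matrix.mul_assoc, Jmat_two_mul_self, Matrix.one_mul]

lemma starJ_transpose_mul_Jmat_two {F : Type*} [Field F] (x : Matrix (Fin 2) (Fin 2) F) :
    (starJ F x)ᵀ * Jmat F 2 = Jmat F 2 * x := by
  simpa [Jmat_transpose] using congrArg transpose (Jmat_two_mul_starJ x)

/-- The only nontrivial block of `ᵗv Ω v = Ω` is the lower right one. -/
lemma vMat_transpose_mul_omegaMat_mul {F : Type*} [Field F] (x y z : Matrix (Fin 2) (Fin 2) F) :
    (vMat F x y z)ᵀ * OmegaMat F 4 * vMat F x y z = blk8 F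
      ![![0, 0, 0, Jmat F 2], ![0, 0, Jmat F 2, 0], ![0, -Jmat F 2, 0, 0],
        ![-Jmat F 2, 0, 0,
          (z - x * starJ F y)ᵀ * Jmat F 2 - Jmat F 2 * (z - x * starJ F y)]] := by
  have hyx : Jmat F 2 * (y * starJ F x) = (starJ F y)ᵀ * (xᵀ * Jmat F 2) := by
    rw [← Jmat_two_mul_starJ, ← Matrix.mul_assoc, ← Matrix.mul_assoc, starJ_transpose_mul_Jmat_two]
  rw [vMat_eq_blk8, omegaMat_four_eq_blk8, blk8_transpose]
  erw [blk8_mul, blk8_mul]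
  congr 1
  funext i j
  fin_cases i <;> fin_cases j <;>
    simp [Fin.sum_univ_four, Jmat_two_mul_starJ, starJ_transpose_mul_Jmat_two, Matrix.mul_sub,
      Matrix.sub_mul, Matrix.mul_assoc, hyx]
  abel

/-- `v(x,y,z) ∈ Sp_8(F)` iff `z - x·y* ∈ Mat_2^0(F)`. -/
theorem statement0 (F : Type*) [Field F] (x y z : Matrix (Fin 2) (Fin 2) F) :
    vMat F x y z ∈ Sp8 F ↔ z - x * starJ F y ∈ Mat20 F := by
  change (vMat F x y z)ᵀ * OmegaMat F 4 * vMat F x y z = OmegaMat F 4 ↔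
    (z - x * starJ F y)ᵀ * Jmat F 2 = Jmat F 2 * (z - x * starJ F y)
  rw [vMat_transpose_mul_omegaMat_mul, omegaMat_four_eq_blk8, blk8_injective.eq_iff,
    ← sub_eq_zero (b := Jmat F 2 * _)]
  simp

end

end GS
end

section
/- Let F be a field. The map t : Sp_4(F) × Sp_4(F) → Mat_16(F) defined below is an injective group homomorphism whose image is contained in Sp_16(F). -/
open Matrix

namespace GS

noncomputable section

/-- The index bijection gathering `I₁`, `I₅`, `I₂ ∪ I₄` and `I₃`, in this order. -/
def tIndex : (Fin 4 ⊕ Fin 4) ⊕ (Fin 4 ⊕ Fin 4) ≃ Fin 16 :=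
  Equiv.ofBijective
    (Sum.elim (Sum.elim ![0, 1, 2, 3] ![12, 13, 14, 15])
      (Sum.elim ![4, 5, 10, 11] ![6, 7, 8, 9]))
    (by decide)

theorem tEmb_submatrix_tIndex (F : Type*) [Field F] (g₁ g₂ : Matrix (Fin 4) (Fin 4) F) :
    (tEmb F g₁ g₂).submatrix tIndex tIndex =
      fromBlocks (fromBlocks g₁ 0 0 (Jmat F 4 * (g₁⁻¹)ᵀ * Jmat F 4)) 0 0
        (fromBlocks g₁ 0 0 g₂) := by
  ext i j
  rcases i with (i | i) | (i | i) <;> rcases j with (j | j) | (j | j) <;>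
    fin_cases i <;> fin_cases j <;> rfl

theorem OmegaMat_submatrix_tIndex (F : Type*) [Field F] :
    (OmegaMat F 8).submatrix tIndex tIndex =
      fromBlocks (fromBlocks 0 (Jmat F 4) (-Jmat F 4) 0) 0 0
        (fromBlocks (OmegaMat F 2) 0 0 (OmegaMat F 2)) := by
  ext i j
  rcases i with (i | i) | (i | i) <;> rcases j with (j | j) | (j | j) <;>
    fin_cases i <;> fin_cases j <;>
    first
      | rfl
      | exact neg_zero

theorem Jmat_mul_self (F : Type*) [Field F] (n : ℕ) : Jmat F n * Jmat F n = 1 := by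
  have h (i j : Fin n) : (i : ℕ) + (j : ℕ) = n - 1 ↔ j = i.rev := by
    rw [Fin.ext_iff, Fin.val_rev]
    omega
  ext i j
  simp only [Matrix.mul_apply, Jmat, of_apply, h, ite_mul, one_mul, zero_mul, Finset.sum_ite_eq',
    Finset.mem_univ, if_true, Fin.rev_rev, Matrix.one_apply, eq_comm]

theorem OmegaMat_mul_self (F : Type*) [Field F] (n : ℕ) :
    OmegaMat F n * OmegaMat F n = -1 := by
  simp only [OmegaMat, reindex_apply, submatrix_mul_equiv, fromBlocks_multiply]
  have h : fromBlocks (-1 : Matrix (Fin n) (Fin n) F) 0 0 (-1 : Matrix (Fin n) (Fin n) F) = -1 := by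
    rw [← fromBlocks_one, fromBlocks_neg, neg_zero]
  simp [Jmat_mul_self, h, submatrix_neg]

theorem isUnit_det_of_mem_SpSet {F : Type*} [Field F] {n : ℕ}
    {g : Matrix (Fin (n + n)) (Fin (n + n)) F} (hg : g ∈ SpSet F n) : IsUnit g.det := by
  refine isUnit_det_of_left_inverse (B := -(OmegaMat F n * gᵀ * OmegaMat F n)) ?_
  have hg' : gᵀ * OmegaMat F n * g = OmegaMat F n := hg
  rw [Matrix.neg_mul, Matrix.mul_assoc, Matrix.mul_assoc, ← Matrix.mul_assoc gᵀ, hg',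
    OmegaMat_mul_self, neg_neg]

theorem tEmb_mem_Sp16 {F : Type*} [Field F] {g₁ g₂ : Matrix (Fin 4) (Fin 4) F}
    (h₁ : g₁ ∈ Sp4 F) (h₂ : g₂ ∈ Sp4 F) : tEmb F g₁ g₂ ∈ Sp16 F := by
  have hdet : IsUnit g₁.det := isUnit_det_of_mem_SpSet (n := 2) h₁
  have hdet' : IsUnit (g₁ᵀ).det := by rwa [det_transpose]
  have hJ := Jmat_mul_self F 4
  have hJt : (Jmat F 4)ᵀ = Jmat F 4 := by
    ext i j
    simp [Jmat, add_comm]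
  have e₁ : g₁ᵀ * OmegaMat F 2 * g₁ = OmegaMat F 2 := h₁
  have e₂ : g₂ᵀ * OmegaMat F 2 * g₂ = OmegaMat F 2 := h₂
  have e₃ : g₁ᵀ * Jmat F 4 * (Jmat F 4 * (g₁⁻¹)ᵀ * Jmat F 4) = Jmat F 4 := by
    simp only [Matrix.mul_assoc]
    rw [← Matrix.mul_assoc (Jmat F 4) (Jmat F 4), hJ, Matrix.one_mul, transpose_nonsing_inv,
      mul_nonsing_inv_cancel_left _ _ hdet']
  have e₄ : Jmat F 4 * g₁⁻¹ * Jmat F 4 * Jmat F 4 * g₁ = Jmat F 4 := by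
    rw [Matrix.mul_assoc _ (Jmat F 4) (Jmat F 4), hJ, Matrix.mul_one,
      nonsing_inv_mul_cancel_right _ _ hdet]
  have key : (tEmb F g₁ g₂)ᵀ * OmegaMat F 8 * tEmb F g₁ g₂ = OmegaMat F 8 := by
    apply (reindex tIndex.symm tIndex.symm).injective
    simp only [reindex_apply, Equiv.symm_symm]
    rw [← submatrix_mul_equiv _ _ _ tIndex, ← submatrix_mul_equiv _ _ _ tIndex,
      ← transpose_submatrix, tEmb_submatrix_tIndex, OmegaMat_submatrix_tIndex]
    simp only [fromBlocks_transpose, fromBlocks_multiply, transpose_zero, Matrix.mul_zero,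
      Matrix.zero_mul, add_zero, zero_add, transpose_mul, transpose_transpose, hJt,
      Matrix.mul_neg, Matrix.neg_mul, neg_zero, e₁, e₂, e₃, ← Matrix.mul_assoc, e₄]
  exact key

theorem tEmb_mul (F : Type*) [Field F] (g₁ g₂ g₁' g₂' : Matrix (Fin 4) (Fin 4) F) :
    tEmb F (g₁ * g₁') (g₂ * g₂') = tEmb F g₁ g₂ * tEmb F g₁' g₂' := by
  have h : Jmat F 4 * ((g₁ * g₁')⁻¹)ᵀ * Jmat F 4 =
      Jmat F 4 * (g₁⁻¹)ᵀ * Jmat F 4 * (Jmat F 4 * (g₁'⁻¹)ᵀ * Jmat F 4) := by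
    simp only [Matrix.mul_assoc]
    rw [← Matrix.mul_assoc (Jmat F 4) (Jmat F 4), Jmat_mul_self, Matrix.one_mul,
      Matrix.mul_inv_rev, transpose_mul, Matrix.mul_assoc]
  apply (reindex tIndex.symm tIndex.symm).injective
  simp only [reindex_apply, Equiv.symm_symm]
  rw [← submatrix_mul_equiv _ _ _ tIndex]
  simp [tEmb_submatrix_tIndex, fromBlocks_multiply, h]

theorem tEmb_inj {F : Type*} [Field F] {g₁ g₂ g₁' g₂' : Matrix (Fin 4) (Fin 4) F}
    (h : tEmb F g₁ g₂ = tEmb F g₁' g₂') : g₁ = g₁' ∧ g₂ = g₂' := by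
  have h' := congrArg (fun M => M.submatrix tIndex tIndex) h
  simp only [tEmb_submatrix_tIndex, fromBlocks_inj] at h'
  exact ⟨h'.1.1, h'.2.2.2.2.2.2⟩

/-- `t : Sp_4(F) × Sp_4(F) → Mat_16(F)` is an injective group homomorphism
with image contained in `Sp_16(F)`. -/
theorem statement7 (F : Type*) [Field F] :
    (∀ g₁ ∈ Sp4 F, ∀ g₂ ∈ Sp4 F, tEmb F g₁ g₂ ∈ Sp16 F) ∧
    (∀ g₁ g₂ g₁' g₂' : Matrix (Fin 4) (Fin 4) F,
      g₁ ∈ Sp4 F → g₂ ∈ Sp4 F → g₁' ∈ Sp4 F → g₂' ∈ Sp4 F →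
      tEmb F (g₁ * g₁') (g₂ * g₂') = tEmb F g₁ g₂ * tEmb F g₁' g₂') ∧
    (∀ g₁ g₂ g₁' g₂' : Matrix (Fin 4) (Fin 4) F,
      g₁ ∈ Sp4 F → g₂ ∈ Sp4 F → g₁' ∈ Sp4 F → g₂' ∈ Sp4 F →
      tEmb F g₁ g₂ = tEmb F g₁' g₂' → g₁ = g₁' ∧ g₂ = g₂') := by
  exact ⟨fun _ h₁ _ h₂ => tEmb_mem_Sp16 h₁ h₂,
    fun g₁ g₂ g₁' g₂' _ _ _ _ => tEmb_mul F g₁ g₂ g₁' g₂',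
    fun _ _ _ _ _ _ _ _ h => tEmb_inj h⟩

end

end GS
end
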